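/- arXiv:2103.09338 — 3 statements merged into one kernel-verified Lean document; each statement's English description precedes it below -/
import Mathlib

section
/- Let N be a natural number, B ⊆ Fin N a set of 'boundary' indices, S : ℝ^N → ℝ a twice continuously differentiable function, and φ ∈ ℝ^N. Suppose V, W ∈ ℝ^N are first variations at φ, i.e. for every index j ∉ B one has Σ_{i=1}^N (∂²S/∂x_j ∂x_i)(φ) · V_i = 0 and Σ_{i=1}^N (∂²S/∂x_j ∂x_i)(φ) · W_i = 0. Then the discrete multisymplectic form formula holds: Σ_{j ∈ B} Σ_{i=1}^N (∂²S/∂x_i ∂x_j)(φ) · (V_i W_j − W_i V_j) = 0. -/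
/-- For a symmetric bilinear form with matrix `H`, if the rows of `H` with index outside `B`
annihilate `V` and `W`, then the partial antisymmetrized sum over the rows in `B` vanishes. -/
theorem sum_symm_mul_antisymm_eq_zero {ι R : Type*} [Fintype ι] [CommRing R]
    (B : Finset ι) (H : ι → ι → R) (hH : ∀ i j, H i j = H j i) (V W : ι → R)
    (hV : ∀ j ∉ B, ∑ i, H j i * V i = 0) (hW : ∀ j ∉ B, ∑ i, H j i * W i = 0) :
    ∑ j ∈ B, ∑ i, H i j * (V i * W j - W i * V j) = 0 := by
  have row (j : ι) : ∑ i, H i j * (V i * W j - W i * V j) =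
      (∑ i, H j i * V i) * W j - (∑ i, H j i * W i) * V j := by
    rw [Finset.sum_mul, Finset.sum_mul, ← Finset.sum_sub_distrib]
    refine Finset.sum_congr rfl fun i _ => ?_
    rw [hH i j]
    ring
  rw [Finset.sum_subset (Finset.subset_univ B) fun j _ hj => by
    rw [row, hV j hj, hW j hj, zero_mul, zero_mul, sub_zero]]
  simp only [mul_sub, Finset.sum_sub_distrib]
  rw [sub_eq_zero, Finset.sum_comm]
  refine Finset.sum_congr rfl fun i _ => Finset.sum_congr rfl fun j _ => ?_
  rw [hH i j]
  ring

/-- **Discrete multisymplectic form formula.**  If `S : ℝ^N → ℝ` is a `C²` discrete action,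
`B` the set of boundary indices, and `V`, `W` are first variations at `φ` (i.e. they are
annihilated by the interior rows `j ∉ B` of the Hessian of `S` at `φ`), then the exterior
derivative of the discrete Cartan form evaluated on `V, W` vanishes. -/
theorem discrete_multisymplectic_form_formula
    (N : ℕ) (B : Finset (Fin N)) (S : (Fin N → ℝ) → ℝ)
    (hS : ContDiff ℝ 2 S) (φ V W : Fin N → ℝ)
    (hV : ∀ j ∉ B, ∑ i : Fin N,
      iteratedFDeriv ℝ 2 S φ ![Pi.single j (1 : ℝ), Pi.single i (1 : ℝ)] * V i = 0)
    (hW : ∀ j ∉ B, ∑ i : Fin N,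
      iteratedFDeriv ℝ 2 S φ ![Pi.single j (1 : ℝ), Pi.single i (1 : ℝ)] * W i = 0) :
    ∑ j ∈ B, ∑ i : Fin N,
      iteratedFDeriv ℝ 2 S φ ![Pi.single i (1 : ℝ), Pi.single j (1 : ℝ)] *
        (V i * W j - W i * V j) = 0 := by
  refine sum_symm_mul_antisymm_eq_zero B
    (fun i j => iteratedFDeriv ℝ 2 S φ ![Pi.single i (1 : ℝ), Pi.single j (1 : ℝ)])
    (fun i j => ?_) V W hV hW
  exact IsSymmSndFDerivAt.iteratedFDeriv_cons
    (hf := hS.contDiffAt.isSymmSndFDerivAt (by simp))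
end

section
/- Let N be a natural number, B ⊆ Fin N, S : ℝ^N → ℝ a differentiable function, and g : ℝ → (ℝ^N → ℝ^N) a one-parameter family of maps with g_0 = id such that S(g_ε(x)) = S(x) for all ε ∈ ℝ and x ∈ ℝ^N. Let φ ∈ ℝ^N be such that ε ↦ g_ε(φ) is differentiable at ε = 0 with derivative ξ ∈ ℝ^N. If φ satisfies the discrete Euler–Lagrange equations, i.e. (∂S/∂x_j)(φ) = 0 for every j ∉ B, then the discrete Noether conservation law holds: Σ_{j ∈ B} (∂S/∂x_j)(φ) · ξ_j = 0. -/
/-- **Discrete Noether's theorem.**  If the differentiable discrete action `S` is invariant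
under a one-parameter family of maps `g` with `g 0 = id`, `ξ` is the infinitesimal generator
of `g` at `φ`, and `φ` satisfies the discrete Euler–Lagrange equations (the interior partial
derivatives `j ∉ B` of `S` vanish at `φ`), then the discrete Cartan form evaluated on `ξ`
vanishes: `Σ_{j ∈ B} (∂S/∂x_j)(φ) · ξ_j = 0`. -/
theorem discrete_noether_theorem
    (N : ℕ) (B : Finset (Fin N)) (S : (Fin N → ℝ) → ℝ)
    (hS : Differentiable ℝ S)
    (g : ℝ → (Fin N → ℝ) → (Fin N → ℝ))
    (hg0 : g 0 = id)
    (hinv : ∀ (ε : ℝ) (x : Fin N → ℝ), S (g ε x) = S x)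
    (φ ξ : Fin N → ℝ)
    (hξ : HasDerivAt (fun ε : ℝ => g ε φ) ξ 0)
    (hDEL : ∀ j ∉ B, fderiv ℝ S φ (Pi.single j (1 : ℝ)) = 0) :
    ∑ j ∈ B, fderiv ℝ S φ (Pi.single j (1 : ℝ)) * ξ j = 0 := by
  have hφ : g 0 φ = φ := by rw [hg0, id]
  have hchain : HasDerivAt (fun ε : ℝ => S (g ε φ)) (fderiv ℝ S φ ξ) 0 :=
    HasFDerivAt.comp_hasDerivAt_of_eq 0 (hS φ).hasFDerivAt hξ hφ.symm
  have hzero : fderiv ℝ S φ ξ = 0 := by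
    simp only [hinv] at hchain
    exact hchain.unique (hasDerivAt_const 0 (S φ))
  have hsum : fderiv ℝ S φ ξ = ∑ j, fderiv ℝ S φ (Pi.single j (1 : ℝ)) * ξ j := by
    rw [← (fderiv ℝ S φ).coe_coe, LinearMap.pi_apply_eq_sum_univ]
    refine Finset.sum_congr rfl fun j _ => ?_
    rw [smul_eq_mul, mul_comm]
    congr 2
    ext i
    simp [Pi.single_apply, eq_comm]
  rw [← hzero, hsum]
  exact Finset.sum_subset (Finset.subset_univ B) fun j _ hj => by rw [hDEL j hj, zero_mul]
end

section
/- Let V and W be real Hilbert spaces, d : V → W a continuous linear map, I = (a,b) an open interval, and ℒ : ℝ × V × V × W → ℝ continuously Fréchet differentiable, with partial Fréchet derivatives D₂ℒ, D₃ℒ, D₄ℒ in the second, third and fourth arguments. Let V_h ⊆ V be a finite-dimensional subspace and φ : ℝ → V a twice continuously differentiable curve. Suppose that for every v ∈ V_h: (i) for every compactly supported smooth u : I → ℝ, the first variation vanishes: ∫_I [ D₂ℒ(t,φ(t),φ'(t),d(φ(t)))(v)·u(t) + D₃ℒ(t,φ(t),φ'(t),d(φ(t)))(v)·u'(t) + D₄ℒ(t,φ(t),φ'(t),d(φ(t)))(d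 v)·u(t) ] dt = 0; and (ii) t ↦ D₃ℒ(t,φ(t),φ'(t),d(φ(t)))(v) is continuously differentiable on I while t ↦ D₂ℒ(t,φ(t),φ'(t),d(φ(t)))(v) and t ↦ D₄ℒ(t,φ(t),φ'(t),d(φ(t)))(d v) are continuous on I. Then for every v ∈ V_h and every t ∈ I the semi-discrete Euler–Lagrange equation holds: (d/dt)[ D₃ℒ(t,φ(t),φ'(t),d(φ(t)))(v) ] = D₂ℒ(t,φ(t),φ'(t),d(φ(t)))(v) + D₄ℒ(t,φ(t),φ'(t),d(φ(t)))(d v). -/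
open MeasureTheory

/-- A function continuous on an open set `U`, multiplied by a continuous function compactly supported
in `U`, is integrable on `ℝ`. -/
theorem ContinuousOn.integrable_mul_of_tsupport_subset {U : Set ℝ} (hU : IsOpen U) {f g : ℝ → ℝ}
    (hf : ContinuousOn f U) (hg : Continuous g) (hgc : HasCompactSupport g)
    (hgU : tsupport g ⊆ U) : Integrable (f * g) := by
  refine Continuous.integrable_of_hasCompactSupport (continuous_of_tsupport fun x hx => ?_)
    (hgc.mul_left)
  have hx' : x ∈ U := hgU (tsupport_mul_subset_right hx)
  exact (hf.continuousAt (hU.mem_nhds hx')).mul hg.continuousAt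

/-- **Du Bois-Reymond lemma**: if `q u + p u'` integrates to zero over an open set for every smooth `u`
compactly supported there, with `p` of class `C¹` and `q` continuous, then `p' = q`. -/
theorem deriv_eq_of_setIntegral_eq_zero {U : Set ℝ} (hU : IsOpen U) {p q : ℝ → ℝ}
    (hp : ContDiffOn ℝ 1 p U) (hq : ContinuousOn q U)
    (h : ∀ u : ℝ → ℝ, ContDiff ℝ (⊤ : ℕ∞) u → HasCompactSupport u → tsupport u ⊆ U →
      ∫ t in U, (q t * u t + p t * deriv u t) = 0) :
    Set.EqOn (deriv p) q U := by
  have hp' : ContinuousOn (deriv p) U := hp.continuousOn_deriv_of_isOpen hU le_rfl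
  have hae : ∀ᵐ t, t ∈ U → (deriv p - q) t = 0 := by
    refine hU.ae_eq_zero_of_integral_contDiff_smul_eq_zero
      ((hp'.sub hq).locallyIntegrableOn hU.measurableSet) fun u hu huc huU => ?_
    have hu'c : HasCompactSupport (deriv u) := huc.deriv
    have hu'U : tsupport (deriv u) ⊆ U :=
      (closure_minimal (support_deriv_subset) (isClosed_tsupport u)).trans huU
    have hu' : Continuous (deriv u) := hu.continuous_deriv (by simp)
    have hpu' := hp.continuousOn.integrable_mul_of_tsupport_subset hU hu' hu'c hu'U
    have hp'u := hp'.integrable_mul_of_tsupport_subset hU hu.continuous huc huU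
    have hqu := hq.integrable_mul_of_tsupport_subset hU hu.continuous huc huU
    have hpu := hp.continuousOn.integrable_mul_of_tsupport_subset hU hu.continuous huc huU
    have hparts : ∫ t, p t * deriv u t = -∫ t, deriv p t * u t :=
      integral_mul_deriv_eq_deriv_mul_of_integrable
        (fun x hx => ((hp.differentiableOn one_ne_zero).differentiableAt
          (hU.mem_nhds (huU hx))).hasDerivAt)
        (fun x _ => (hu.differentiable (by simp) x).hasDerivAt) hpu' hp'u hpu
    have hzero := h u hu huc huU
    rw [setIntegral_eq_integral_of_forall_compl_eq_zero fun t ht => by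
      rw [image_eq_zero_of_notMem_tsupport fun hx => ht (huU hx),
        image_eq_zero_of_notMem_tsupport fun hx => ht (hu'U hx)]; simp] at hzero
    have hadd : ∫ t, (q t * u t + p t * deriv u t) = (∫ t, q t * u t) + ∫ t, p t * deriv u t :=
      integral_add hqu hpu'
    have hsub : ∫ t, (deriv p t * u t - q t * u t) = (∫ t, deriv p t * u t) - ∫ t, q t * u t :=
      integral_sub hp'u hqu
    calc ∫ t, u t • (deriv p - q) t = ∫ t, (deriv p t * u t - q t * u t) := by
          congr 1 with t
          simp only [Pi.sub_apply, smul_eq_mul]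
          ring
      _ = 0 := by linarith
  refine Measure.eqOn_open_of_ae_eq (μ := volume) ?_ hU hp' hq
  filter_upwards [(ae_restrict_iff' hU.measurableSet).2 hae] with t ht
  exact sub_eq_zero.1 ht

/-- **Semi-discrete Euler–Lagrange equations.**  Let `V`, `W` be real Hilbert spaces,
`d : V → W` continuous linear, `ℒ : ℝ × V × V × W → ℝ` a `C¹` Lagrangian density, `Vh` a
finite-dimensional subspace of `V` and `φ : ℝ → V` a `C²` curve.  If the first variation
of the action vanishes for all separated variations `u(t)·v` with `v ∈ Vh` and
`u ∈ C_c^∞(I)` (hypothesis `hvar`), and the relevant coefficient functions have the stated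
regularity on `I = (a,b)` (hypothesis `hreg`), then for every `v ∈ Vh` and `t ∈ I`,
`(d/dt)[D₃ℒ(j¹φ)(v)] = D₂ℒ(j¹φ)(v) + D₄ℒ(j¹φ)(d v)`. -/
theorem semi_discrete_euler_lagrange
    {V W : Type*} [NormedAddCommGroup V] [InnerProductSpace ℝ V] [CompleteSpace V]
    [NormedAddCommGroup W] [InnerProductSpace ℝ W] [CompleteSpace W]
    (d : V →L[ℝ] W) (a b : ℝ)
    (ℒ : ℝ × V × V × W → ℝ) (hℒ : ContDiff ℝ 1 ℒ)
    (Vh : Submodule ℝ V) (hVh : FiniteDimensional ℝ Vh)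
    (φ : ℝ → V) (hφ : ContDiff ℝ 2 φ)
    (hvar : ∀ v ∈ Vh, ∀ u : ℝ → ℝ, ContDiff ℝ (⊤ : ℕ∞) u → HasCompactSupport u →
      tsupport u ⊆ Set.Ioo a b →
      ∫ t in Set.Ioo a b,
        (fderiv ℝ (fun x => ℒ (t, x, deriv φ t, d (φ t))) (φ t) v * u t
          + fderiv ℝ (fun y => ℒ (t, φ t, y, d (φ t))) (deriv φ t) v * deriv u t
          + fderiv ℝ (fun z => ℒ (t, φ t, deriv φ t, z)) (d (φ t)) (d v) * u t) = 0)
    (hreg : ∀ v ∈ Vh,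
      ContDiffOn ℝ 1
        (fun t => fderiv ℝ (fun y => ℒ (t, φ t, y, d (φ t))) (deriv φ t) v)
        (Set.Ioo a b) ∧
      ContinuousOn
        (fun t => fderiv ℝ (fun x => ℒ (t, x, deriv φ t, d (φ t))) (φ t) v)
        (Set.Ioo a b) ∧
      ContinuousOn
        (fun t => fderiv ℝ (fun z => ℒ (t, φ t, deriv φ t, z)) (d (φ t)) (d v))
        (Set.Ioo a b)) :
    ∀ v ∈ Vh, ∀ t ∈ Set.Ioo a b,
      deriv (fun s => fderiv ℝ (fun y => ℒ (s, φ s, y, d (φ s))) (deriv φ s) v) t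
        = fderiv ℝ (fun x => ℒ (t, x, deriv φ t, d (φ t))) (φ t) v
          + fderiv ℝ (fun z => ℒ (t, φ t, deriv φ t, z)) (d (φ t)) (d v) := by
  intro v hv
  obtain ⟨hp, hq, hr⟩ := hreg v hv
  refine deriv_eq_of_setIntegral_eq_zero isOpen_Ioo hp (hq.add hr) fun u hu huc huU => ?_
  rw [← hvar v hv u hu huc huU]
  congr 1 with t
  ring
end
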